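/- arXiv:2302.14123 — 6 statements merged into one kernel-verified Lean document; each statement's English description precedes it below -/
import Mathlib

section
/- For the median outcome function with empty-item cost c ≥ (1/2)·|β_a − β_b|, if either n_a + n_b ≥ 2m + 1, or n_a + n_b = 2m with both n_a and n_b even, then there exists a Nash stable arrangement of the agents onto the m items. -/
open Finset

/-- Median outcome on an item with `ai` type-A agents (bias `βa`) and `bi` type-B agents
(bias `βb`): `βa` if `ai > bi`, `βb` if `ai < bi`, the average if they tie. -/
noncomputable def medOut (βa βb : ℝ) (ai bi : ℕ) : ℝ :=
  if bi < ai then βa else if ai < bi then βb else (βa + βb) / 2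

/-- Mean outcome on an item with `ai` type-A agents and `bi` type-B agents. -/
noncomputable def meanOut (βa βb : ℝ) (ai bi : ℕ) : ℝ :=
  ((ai : ℝ) * βa + (bi : ℝ) * βb) / ((ai : ℝ) + (bi : ℝ))

/-- Total cost, with per-item outcome function `f` (applied to the counts on each item),
to an agent of bias `β`, with empty-item cost `c`. -/
noncomputable def pbCost {m : ℕ} (f : ℕ → ℕ → ℝ) (β c : ℝ) (a b : Fin m → ℕ) : ℝ :=
  ∑ i, if a i + b i = 0 then c else |f (a i) (b i) - β|

/-- Move one agent from item `i` to item `j`. -/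
def pbMove {m : ℕ} (x : Fin m → ℕ) (i j : Fin m) : Fin m → ℕ :=
  Function.update (Function.update x i (x i - 1)) j (x j + 1)

/-- Nash stability: no single agent can strictly decrease its own total cost by
moving from one item to another. -/
def NashStable {m : ℕ} (f : ℕ → ℕ → ℝ) (βa βb c : ℝ) (a b : Fin m → ℕ) : Prop :=
  ∀ i j : Fin m, i ≠ j →
    (1 ≤ a i → pbCost f βa c a b ≤ pbCost f βa c (pbMove a i j) b) ∧
    (1 ≤ b i → pbCost f βb c a b ≤ pbCost f βb c a (pbMove b i j))

/-- The median-critical region of `(n_a, n_b)` pairs for `m` items. -/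
def MedianCritical (m na nb : ℕ) : Prop :=
  (na + nb ≤ 2 * m ∧ m < na ∧ 1 ≤ nb ∧ nb + m < na) ∨
  (na + nb ≤ 2 * m ∧ m < nb ∧ 1 ≤ na ∧ na + m < nb)

theorem medOut_swap (βa βb : ℝ) (x y : ℕ) : medOut βb βa y x = medOut βa βb x y := by
  unfold medOut
  split_ifs <;> first | rfl | omega | ring

/-- Exchanging the roles of the two types preserves stability. -/
theorem NashStable.medOut_swap {m : ℕ} {βa βb c : ℝ} {a b : Fin m → ℕ}
    (h : NashStable (medOut βb βa) βb βa c b a) : NashStable (medOut βa βb) βa βb c a b := by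
  have key : ∀ (β : ℝ) (x y : Fin m → ℕ),
      pbCost (medOut βa βb) β c x y = pbCost (medOut βb βa) β c y x := by
    intro β x y
    simp only [pbCost, _root_.medOut_swap βa βb, add_comm]
  intro i j hij
  simp only [key]
  exact (h i j hij).symm

theorem pbMove_le_add_one {m : ℕ} (x : Fin m → ℕ) (i j l : Fin m) :
    pbMove x i j l ≤ x l + 1 := by
  simp only [pbMove, Function.update_apply]
  split_ifs <;> subst_vars <;> omega

theorem le_pbMove_add_one {m : ℕ} (x : Fin m → ℕ) (i j l : Fin m) :
    x l ≤ pbMove x i j l + 1 := by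
  simp only [pbMove, Function.update_apply]
  split_ifs <;> subst_vars <;> omega

/-- The cost of a type is unchanged as long as no item changes its strict majority. -/
theorem pbCost_medOut_congr {m : ℕ} {βa βb β c : ℝ} {a b a' b' : Fin m → ℕ}
    (h : ∀ i, (b i < a i ∧ b' i < a' i) ∨ (a i < b i ∧ a' i < b' i)) :
    pbCost (medOut βa βb) β c a b = pbCost (medOut βa βb) β c a' b' := by
  refine Finset.sum_congr rfl fun i _ => ?_
  rcases h i with ⟨h₁, h₂⟩ | ⟨h₁, h₂⟩
  · rw [if_neg (by omega), if_neg (by omega)]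
    simp [medOut, h₁, h₂]
  · rw [if_neg (by omega), if_neg (by omega)]
    simp [medOut, h₁, h₂, h₁.not_gt, h₂.not_gt]

/-- If every item is won by a margin of at least two, no single move changes any outcome. -/
theorem nashStable_medOut_of_margin {m : ℕ} {βa βb c : ℝ} {a b : Fin m → ℕ}
    (h : ∀ i, b i + 2 ≤ a i ∨ a i + 2 ≤ b i) : NashStable (medOut βa βb) βa βb c a b := by
  refine fun i j _ => ⟨fun _ => (pbCost_medOut_congr fun l => ?_).le,
    fun _ => (pbCost_medOut_congr fun l => ?_).le⟩
  · have := pbMove_le_add_one a i j l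
    have := le_pbMove_add_one a i j l
    have := h l
    omega
  · have := pbMove_le_add_one b i j l
    have := le_pbMove_add_one b i j l
    have := h l
    omega

/-- If type `A` wins every item and the only possible type-`B` agent is alone, the
arrangement is stable. -/
theorem nashStable_medOut_single {m : ℕ} {βa βb c : ℝ} (hc : 0 ≤ c) {a : Fin m → ℕ}
    (ha : ∀ i, 2 ≤ a i) (i₀ : Fin m) {n : ℕ} (hn : n ≤ 1) :
    NashStable (medOut βa βb) βa βb c a (Pi.single i₀ n) := by
  have hb : ∀ l, (Pi.single i₀ n : Fin m → ℕ) l ≤ 1 := fun l => by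
    rw [Pi.single_apply]; split_ifs <;> omega
  refine fun i j hij => ⟨fun _ => ?_, fun hi => (pbCost_medOut_congr fun l => Or.inl ?_).le⟩
  · refine Finset.sum_le_sum fun l _ => ?_
    have h₁ := ha l
    have h₂ := hb l
    rw [if_neg (by omega), medOut, if_pos (by omega), sub_self, abs_zero]
    split_ifs
    exacts [hc, abs_nonneg _]
  · have h₁ := ha l
    have h₂ := hb l
    have hii : i = i₀ := by
      by_contra hne
      simp [hne] at hi
    subst hii
    refine ⟨by omega, ?_⟩
    simp only [pbMove, Function.update_apply, Pi.single_apply, if_neg hij.symm]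
    split_ifs <;> omega

theorem exists_sum_eq_two_le_on {m n : ℕ} (S : Finset (Fin m)) (hS : S.Nonempty)
    (h : 2 * S.card ≤ n) :
    ∃ x : Fin m → ℕ, ∑ i, x i = n ∧ (∀ i ∈ S, 2 ≤ x i) ∧ ∀ i ∉ S, x i = 0 := by
  obtain ⟨i₀, hi₀⟩ := hS
  refine ⟨fun i => (if i ∈ S then 2 else 0) + if i = i₀ then n - 2 * S.card else 0, ?_, ?_, ?_⟩
  · rw [Finset.sum_add_distrib]
    simp
    omega
  · intro i hi
    simp [hi]
  · intro i hi
    have : i ≠ i₀ := fun e => hi (e ▸ hi₀)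
    simp [hi, this]

theorem exists_nashStable_medOut_of_le_one {m : ℕ} (hm : 0 < m) {βa βb c : ℝ} (hc : 0 ≤ c)
    {na nb : ℕ} (ha : 2 * m ≤ na) (hb : nb ≤ 1) :
    ∃ a b : Fin m → ℕ, (∑ i, a i = na) ∧ (∑ i, b i = nb) ∧
      NashStable (medOut βa βb) βa βb c a b := by
  obtain ⟨a, hsum, h2, -⟩ := exists_sum_eq_two_le_on (n := na) (univ : Finset (Fin m))
    ⟨⟨0, hm⟩, mem_univ _⟩ (by simpa using ha)
  exact ⟨a, Pi.single ⟨0, hm⟩ nb, hsum, by simp,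
    nashStable_medOut_single hc (fun i => h2 i (mem_univ i)) _ hb⟩

/-- median outcome, `c ≥ (1/2)·|β_a − β_b|`; if `n_a + n_b ≥ 2m + 1`, or
`n_a + n_b = 2m` with both counts even, a Nash stable arrangement exists. -/
theorem stmt2 (m : ℕ) (hm : 0 < m) (βa βb c : ℝ)
    (hc : (1 / 2) * |βa - βb| ≤ c) (na nb : ℕ)
    (hn : 2 * m + 1 ≤ na + nb ∨ (na + nb = 2 * m ∧ Even na ∧ Even nb)) :
    ∃ a b : Fin m → ℕ, (∑ i, a i = na) ∧ (∑ i, b i = nb) ∧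
      NashStable (medOut βa βb) βa βb c a b := by
  have hc₀ : 0 ≤ c := le_trans (by positivity) hc
  have hk : 2 * m ≤ 2 * (na / 2) + 2 * (nb / 2) ∨ 2 * m + 1 ≤ na + nb := by
    rcases hn with h | ⟨h, ⟨x, hx⟩, ⟨y, hy⟩⟩ <;> omega
  by_cases hb : nb ≤ 1
  · exact exists_nashStable_medOut_of_le_one hm hc₀ (by omega) hb
  by_cases ha : na ≤ 1
  · obtain ⟨b, a, hb', ha', hst⟩ :=
      exists_nashStable_medOut_of_le_one (βa := βb) (βb := βa) hm hc₀
        (show 2 * m ≤ nb by omega) ha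
    exact ⟨a, b, ha', hb', hst.medOut_swap⟩
  obtain rfl | hm1 : m = 1 ∨ 2 ≤ m := by omega
  · exact ⟨fun _ => na, fun _ => nb, by simp, by simp,
      fun i j hij => absurd (Subsingleton.elim i j) hij⟩
  obtain ⟨k, hk1, hkm, hkb, hka⟩ :
      ∃ k, 1 ≤ k ∧ k < m ∧ 2 * k ≤ nb ∧ 2 * (m - k) ≤ na :=
    ⟨min (m - 1) (nb / 2), by omega, by omega, by omega, by omega⟩
  obtain ⟨S, -, hS⟩ := Finset.exists_subset_card_eq
    (show k ≤ (univ : Finset (Fin m)).card by simpa using hkm.le)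
  have hSc : Sᶜ.card = m - k := by rw [card_compl, hS, Fintype.card_fin]
  obtain ⟨a, hsa, ha2, ha0⟩ := exists_sum_eq_two_le_on (n := na) Sᶜ
    (card_pos.mp (by omega)) (by omega)
  obtain ⟨b, hsb, hb2, hb0⟩ := exists_sum_eq_two_le_on (n := nb) S
    (card_pos.mp (by omega)) (by omega)
  refine ⟨a, b, hsa, hsb, nashStable_medOut_of_margin fun i => ?_⟩
  by_cases hi : i ∈ S
  · have h₁ := hb2 i hi
    have h₂ := ha0 i (by simpa using hi)
    omega
  · have h₁ := ha2 i (by simpa using hi)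
    have h₂ := hb0 i hi
    omega
end

section
/- For the mean outcome function with β_a ≠ β_b and empty-item cost c ≥ (1/2)·|β_a − β_b|: for every pair of natural numbers n_a ≥ n_b, there exist n_a' ≥ n_a and n_b' ≥ n_b (specifically n_a' and n_b' odd with n_a' = n_b' + 2) such that for m = 2 items there is no Nash stable arrangement of n_a' type-A and n_b' type-B agents onto the items. -/
open Finset

/-- The cost of a single item to an agent whose type has `x` members there, against `y` of the
other type, when the two biases are at distance `D`. -/
noncomputable def meanItemCost (D c : ℝ) (x y : ℕ) : ℝ :=
  if x + y = 0 then c else D * (y / (x + y))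

lemma ite_abs_meanOut_sub_left (βa βb c : ℝ) (x y : ℕ) :
    (if x + y = 0 then c else |meanOut βa βb x y - βa|) = meanItemCost |βa - βb| c x y := by
  unfold meanItemCost
  split_ifs with h
  · rfl
  · have hpos : (0 : ℝ) < x + y := by exact_mod_cast Nat.pos_of_ne_zero h
    have : meanOut βa βb x y - βa = (βb - βa) * (y / (x + y)) := by
      unfold meanOut
      field_simp
      ring
    rw [this, abs_mul, abs_sub_comm, abs_of_nonneg (by positivity : (0 : ℝ) ≤ y / (x + y))]

lemma meanOut_swap (βa βb : ℝ) (x y : ℕ) : meanOut βa βb x y = meanOut βb βa y x := by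
  unfold meanOut
  rw [add_comm, add_comm (x : ℝ)]

lemma pbCost_meanOut_swap {m : ℕ} (βa βb β c : ℝ) (a b : Fin m → ℕ) :
    pbCost (meanOut βa βb) β c a b = pbCost (meanOut βb βa) β c b a := by
  simp only [pbCost, meanOut_swap βa βb, add_comm]

lemma NashStable.swap {m : ℕ} {βa βb c : ℝ} {a b : Fin m → ℕ}
    (h : NashStable (meanOut βa βb) βa βb c a b) :
    NashStable (meanOut βb βa) βb βa c b a := by
  intro i j hij
  have hab := h i j hij
  simp only [pbCost_meanOut_swap βa βb] at hab
  exact hab.symm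

lemma sum_fin_two_of_ne {M : Type*} [AddCommMonoid M] (f : Fin 2 → M) {i j : Fin 2}
    (hij : i ≠ j) : ∑ k, f k = f i + f j := by
  rw [Fin.sum_univ_two]
  fin_cases i <;> fin_cases j <;> simp_all [add_comm]

lemma pbCost_meanOut_fin_two (βa βb c : ℝ) (a b : Fin 2 → ℕ) {i j : Fin 2} (hij : i ≠ j) :
    pbCost (meanOut βa βb) βa c a b =
      meanItemCost |βa - βb| c (a i) (b i) + meanItemCost |βa - βb| c (a j) (b j) := by
  simp only [pbCost, ite_abs_meanOut_sub_left, sum_fin_two_of_ne _ hij]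

lemma NashStable.meanItemCost_le {βa βb c : ℝ} {a b : Fin 2 → ℕ}
    (h : NashStable (meanOut βa βb) βa βb c a b) {i j : Fin 2} (hij : i ≠ j) (hi : 1 ≤ a i) :
    meanItemCost |βa - βb| c (a i) (b i) + meanItemCost |βa - βb| c (a j) (b j) ≤
      meanItemCost |βa - βb| c (a i - 1) (b i) + meanItemCost |βa - βb| c (a j + 1) (b j) := by
  have hc := (h i j hij).1 hi
  rw [pbCost_meanOut_fin_two _ _ _ _ _ hij, pbCost_meanOut_fin_two _ _ _ _ _ hij] at hc
  simpa [pbMove, Function.update_of_ne hij] using hc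

/-- Leaving an item with other agents on it for another nonempty item is unprofitable only if
this polynomial inequality holds. -/
lemma mul_le_mul_of_meanItemCost_le {D c : ℝ} (hD : 0 < D) {x y z w : ℕ} (hx : 1 ≤ x)
    (hxy : 2 ≤ x + y) (hzw : 1 ≤ z + w)
    (h : meanItemCost D c x y + meanItemCost D c z w ≤
      meanItemCost D c (x - 1) y + meanItemCost D c (z + 1) w) :
    w * ((x + y) * (x + y - 1)) ≤ y * ((z + w) * (z + w + 1)) := by
  obtain ⟨x, rfl⟩ := Nat.exists_eq_add_of_le' hx
  have hxy' : 0 < x + y := by omega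
  have hsub : x + 1 + y - 1 = x + y := by omega
  rw [hsub]
  simp only [meanItemCost, Nat.add_sub_cancel] at h
  rw [if_neg (by omega), if_neg (by omega), if_neg (by omega), if_neg (by omega),
    ← mul_add, ← mul_add] at h
  replace h := le_of_mul_le_mul_left h hD
  have hp : (0 : ℝ) < x + y := by exact_mod_cast hxy'
  have hq : (0 : ℝ) < z + w := by exact_mod_cast hzw
  push_cast at h
  have e1 : (y : ℝ) / (x + y) - y / (x + 1 + y) = y / ((x + 1 + y) * (x + y)) := by
    field_simp
    ring
  have e2 : (w : ℝ) / (z + w) - w / (z + 1 + w) = w / ((z + w) * (z + w + 1)) := by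
    field_simp
    ring
  have h' : (w : ℝ) / ((z + w) * (z + w + 1)) ≤ y / ((x + 1 + y) * (x + y)) := by linarith
  rw [div_le_div_iff₀ (by positivity) (by positivity)] at h'
  exact_mod_cast h'

lemma NashStable.mul_le_mul {βa βb c : ℝ} (hβ : βa ≠ βb) {a b : Fin 2 → ℕ}
    (h : NashStable (meanOut βa βb) βa βb c a b) {i j : Fin 2} (hij : i ≠ j) (hi : 1 ≤ a i)
    (hi2 : 2 ≤ a i + b i) (hj : 1 ≤ a j + b j) :
    b j * ((a i + b i) * (a i + b i - 1)) ≤ b i * ((a j + b j) * (a j + b j + 1)) :=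
  mul_le_mul_of_meanItemCost_le (abs_pos.2 (sub_ne_zero.2 hβ)) hi hi2 hj
    (h.meanItemCost_le hij hi)

/-- A stable arrangement has no empty item: an agent of the other item would move there. -/
lemma NashStable.not_empty_item {βa βb c : ℝ} (hβ : βa ≠ βb) (hc : (1 / 2) * |βa - βb| ≤ c)
    {a b : Fin 2 → ℕ} (h : NashStable (meanOut βa βb) βa βb c a b) {i j : Fin 2} (hij : i ≠ j)
    (hi : 1 ≤ a i) (hi3 : 3 ≤ a i + b i) : a j + b j ≠ 0 := by
  intro hj
  have hD := abs_pos.2 (sub_ne_zero.2 hβ)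
  have hle := h.meanItemCost_le hij hi
  obtain ⟨haj, hbj⟩ : a j = 0 ∧ b j = 0 := by omega
  obtain ⟨x, hx⟩ := Nat.exists_eq_add_of_le' hi
  simp only [meanItemCost, haj, hbj, hx, Nat.add_sub_cancel] at hle
  rw [if_neg (by omega), if_pos trivial, if_neg (by omega), if_neg (by omega)] at hle
  push_cast at hle
  set D := |βa - βb|
  have hp : (2 : ℝ) ≤ x + b i := by exact_mod_cast (by omega : 2 ≤ x + b i)
  have hx0 : (0 : ℝ) ≤ x := by positivity
  have hb0 : (0 : ℝ) ≤ b i := by positivity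
  have e1 : (b i : ℝ) / (x + b i) - b i / (x + 1 + b i) = b i / ((x + 1 + b i) * (x + b i)) := by
    field_simp
    ring
  have e2 : (b i : ℝ) / ((x + 1 + b i) * (x + b i)) < 1 / 2 := by
    rw [div_lt_div_iff₀ (by positivity) (by norm_num)]
    nlinarith
  have e3 := mul_lt_mul_of_pos_left e2 hD
  rw [← e1] at e3
  simp only [zero_div, mul_zero, add_zero] at hle
  linarith

/-- For `n` odd, no stable arrangement of `n + 2` and `n` agents has its larger item at `i`. -/
lemma NashStable.not_add_le_add {βa βb c : ℝ} (hβ : βa ≠ βb) (hc : (1 / 2) * |βa - βb| ≤ c)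
    {a b : Fin 2 → ℕ} (h : NashStable (meanOut βa βb) βa βb c a b) {i j : Fin 2} (hij : i ≠ j)
    {n : ℕ} (hn : Odd n) (hn3 : 3 ≤ n) (ha : a i + a j = n + 2) (hb : b i + b j = n) :
    ¬ a j + b j ≤ a i + b i := by
  intro hle
  have hji := hij.symm
  have hi : 1 ≤ a i := by omega
  have hj0 : 1 ≤ a j + b j :=
    Nat.one_le_iff_ne_zero.2 (h.not_empty_item hβ hc hij hi (by omega))
  have hai := h.mul_le_mul hβ hij hi (by omega) hj0
  have hbi := h.swap.mul_le_mul hβ.symm hij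
  have haj := h.mul_le_mul hβ hji
  generalize a i = p at *
  generalize a j = q at *
  generalize b i = r at *
  generalize b j = s at *
  obtain rfl | hr := Nat.eq_zero_or_pos r
  · simp only [zero_mul, nonpos_iff_eq_zero, mul_eq_zero] at hai
    omega
  replace hbi := hbi hr (by omega) (by omega)
  obtain ⟨k, rfl⟩ := hn
  obtain ⟨u, hu⟩ : ∃ u, p + r = 2 * k + 2 + u := Nat.exists_eq_add_of_le (by omega)
  obtain ⟨v, hv⟩ : ∃ v, p + r = v + 1 := ⟨p + r - 1, by omega⟩
  rw [add_comm s q, add_comm r p] at hbi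
  have hlarge : v ≤ q + s + 1 := by
    rw [hv, Nat.add_sub_cancel, ← hv] at hai hbi
    have hpos : 0 < (p + r) * (q + s) := by positivity
    refine Nat.le_of_mul_le_mul_left ?_ hpos
    linarith
  obtain rfl | rfl : u = 0 ∨ u = 1 := by omega
  · replace haj := haj (by omega) (by omega) (by omega)
    have hN : q + s = 2 * k + 2 := by omega
    have hpred : 2 * k + 2 + 0 - 1 = 2 * k + 1 := by omega
    have hpred' : 2 * k + 2 - 1 = 2 * k + 1 := by omega
    rw [hu, hN, hpred] at hai
    rw [hu, hN, hpred'] at haj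
    have h1 : s * (2 * k + 1) ≤ r * (2 * k + 3) :=
      Nat.le_of_mul_le_mul_left (by linarith) (by omega : 0 < 2 * k + 2)
    have h2 : r * (2 * k + 1) ≤ s * (2 * k + 3) :=
      Nat.le_of_mul_le_mul_left (by linarith) (by omega : 0 < 2 * k + 2)
    obtain hlt | hlt : r + 1 ≤ s ∨ s + 1 ≤ r := by omega
    · have := Nat.mul_le_mul_right (2 * k + 1) hlt
      have : 2 * k + 1 ≤ 2 * r := by linarith
      omega
    · have := Nat.mul_le_mul_right (2 * k + 1) hlt
      have : 2 * k + 1 ≤ 2 * s := by linarith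
      omega
  · have hN : q + s = 2 * k + 1 := by omega
    have hpred : 2 * k + 2 + 1 - 1 = 2 * k + 2 := by omega
    rw [hu, hN, hpred] at hai hbi
    have h1 : s * (2 * k + 3) ≤ r * (2 * k + 1) :=
      Nat.le_of_mul_le_mul_left (by linarith) (by omega : 0 < 2 * k + 2)
    have h2 : q * (2 * k + 3) ≤ p * (2 * k + 1) :=
      Nat.le_of_mul_le_mul_left (by linarith) (by omega : 0 < 2 * k + 2)
    have hs : s * (2 * k + 3) = r * (2 * k + 1) := by
      have e1 : (q + s) * (2 * k + 3) = (2 * k + 1) * (2 * k + 3) := by rw [hN]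
      have e2 : (p + r) * (2 * k + 1) = (2 * k + 2 + 1) * (2 * k + 1) := by rw [hu]
      linarith
    have heven : 2 * (s * (2 * k + 2)) = 2 * (2 * (k * k + k)) + 1 := by
      have e : (r + s) * (2 * k + 1) = (2 * k + 1) * (2 * k + 1) := by rw [hb]
      linarith
    omega

/-- mean outcome, `β_a ≠ β_b`, `c ≥ (1/2)·|β_a − β_b|`: for any `n_a ≥ n_b`
there are larger counts `n_a' ≥ n_a`, `n_b' ≥ n_b` (both odd, `n_a' = n_b' + 2`) such that
no Nash stable arrangement on `m = 2` items exists. -/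
theorem stmt5 (βa βb c : ℝ) (hβ : βa ≠ βb)
    (hc : (1 / 2) * |βa - βb| ≤ c) (na nb : ℕ) (hab : nb ≤ na) :
    ∃ na' nb' : ℕ, na ≤ na' ∧ nb ≤ nb' ∧ Odd na' ∧ Odd nb' ∧ na' = nb' + 2 ∧
      ¬ ∃ a b : Fin 2 → ℕ, (∑ i, a i = na') ∧ (∑ i, b i = nb') ∧
        NashStable (meanOut βa βb) βa βb c a b := by
  refine ⟨2 * na + 5, 2 * na + 3, by omega, by omega, ⟨na + 2, by ring⟩, ⟨na + 1, by ring⟩, rfl, ?_⟩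
  rintro ⟨a, b, ha, hb, h⟩
  have hn : Odd (2 * na + 3) := ⟨na + 1, by ring⟩
  rw [Fin.sum_univ_two] at ha hb
  obtain hle | hle := le_total (a 1 + b 1) (a 0 + b 0)
  · exact h.not_add_le_add hβ hc zero_ne_one hn (by omega) ha hb hle
  · exact h.not_add_le_add hβ hc one_ne_zero hn (by omega) (by omega) (by omega) hle
end

section
/- If there are exactly two agents in total, one of each type (n_a = n_b = 1), and m ≥ 2 items, then for any real biases β_a, β_b and any empty-item cost c ≥ 0, a Nash stable arrangement exists, both for the median outcome function and for the mean outcome function. -/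
open Finset

lemma eq_of_one_le_single {m : ℕ} {p i : Fin m}
    (hi : 1 ≤ (Pi.single p 1 : Fin m → ℕ) i) : i = p := by
  by_contra h
  simp [h] at hi

lemma pbMove_single {m : ℕ} {p i j : Fin m} (hij : i ≠ j)
    (hi : 1 ≤ (Pi.single p 1 : Fin m → ℕ) i) :
    pbMove (Pi.single p 1) i j = Pi.single j 1 := by
  obtain rfl := eq_of_one_le_single hi
  funext k
  by_cases hj : k = j <;> by_cases hk : k = i <;>
    simp_all [pbMove]

lemma pbCost_single_self {m : ℕ} (f : ℕ → ℕ → ℝ) (β c : ℝ) (p : Fin m) :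
    pbCost f β c (Pi.single p 1) (Pi.single p 1) = |f 1 1 - β| + c * (m - 1) := by
  have h : ∀ i : Fin m, (if (Pi.single p 1 : Fin m → ℕ) i + (Pi.single p 1 : Fin m → ℕ) i = 0
      then c else |f ((Pi.single p 1 : Fin m → ℕ) i) ((Pi.single p 1 : Fin m → ℕ) i) - β|) =
      c + if i = p then |f 1 1 - β| - c else 0 := by
    intro i
    by_cases hi : i = p <;> simp [hi]
  rw [pbCost, Finset.sum_congr rfl fun i _ => h i, Finset.sum_add_distrib]
  simp
  ring

lemma pbCost_single_of_ne {m : ℕ} (f : ℕ → ℕ → ℝ) (β c : ℝ) {p q : Fin m} (hpq : p ≠ q) :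
    pbCost f β c (Pi.single p 1) (Pi.single q 1) =
      |f 1 0 - β| + |f 0 1 - β| + c * (m - 2) := by
  have h : ∀ i : Fin m, (if (Pi.single p 1 : Fin m → ℕ) i + (Pi.single q 1 : Fin m → ℕ) i = 0
      then c else |f ((Pi.single p 1 : Fin m → ℕ) i) ((Pi.single q 1 : Fin m → ℕ) i) - β|) =
      c + ((if i = p then |f 1 0 - β| - c else 0) + if i = q then |f 0 1 - β| - c else 0) := by
    intro i
    by_cases hi : i = p
    · subst hi
      simp [hpq]
    · by_cases hq : i = q <;> simp [hi, hq, hpq.symm]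
  rw [pbCost, Finset.sum_congr rfl fun i _ => h i, Finset.sum_add_distrib,
    Finset.sum_add_distrib]
  simp
  ring

/-- With one agent of each type, sharing an item is stable when `2 * c ≤ |βa - βb|`, and
occupying distinct items is stable otherwise. -/
lemma exists_nashStable_one_one {m : ℕ} (hm : 2 ≤ m) (f : ℕ → ℕ → ℝ) (βa βb c : ℝ)
    (h10 : f 1 0 = βa) (h01 : f 0 1 = βb) (h11 : f 1 1 = (βa + βb) / 2) :
    ∃ a b : Fin m → ℕ, (∑ i, a i = 1) ∧ (∑ i, b i = 1) ∧ NashStable f βa βb c a b := by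
  have ha : |f 1 1 - βa| = |βa - βb| / 2 := by
    rw [h11, show (βa + βb) / 2 - βa = -((βa - βb) / 2) by ring, abs_neg, abs_div, abs_two]
  have hb : |f 1 1 - βb| = |βa - βb| / 2 := by
    rw [h11, show (βa + βb) / 2 - βb = (βa - βb) / 2 by ring, abs_div, abs_two]
  have hba : |βb - βa| = |βa - βb| := abs_sub_comm _ _
  let p : Fin m := ⟨0, by omega⟩
  let q : Fin m := ⟨1, by omega⟩
  have hpq : p ≠ q := by simp [p, q]
  rcases le_total (2 * c) |βa - βb| with h | h
  · refine ⟨Pi.single p 1, Pi.single p 1, by simp, by simp, fun i j hij => ⟨?_, ?_⟩⟩ <;>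
      intro hi <;> rw [pbMove_single hij hi] <;> obtain rfl := eq_of_one_le_single hi
    · rw [pbCost_single_self, pbCost_single_of_ne _ _ _ hij.symm, ha, h10, h01, hba]
      simp only [sub_self, abs_zero]
      linarith
    · rw [pbCost_single_self, pbCost_single_of_ne _ _ _ hij, hb, h10, h01]
      simp only [sub_self, abs_zero]
      linarith
  · refine ⟨Pi.single p 1, Pi.single q 1, by simp, by simp, fun i j hij => ⟨?_, ?_⟩⟩ <;>
      intro hi <;> rw [pbMove_single hij hi]
    · by_cases hj : j = q
      · rw [hj, pbCost_single_self, pbCost_single_of_ne _ _ _ hpq, ha, h10, h01, hba]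
        simp only [sub_self, abs_zero]
        linarith
      · rw [pbCost_single_of_ne _ _ _ hpq, pbCost_single_of_ne _ _ _ hj]
    · by_cases hj : p = j
      · rw [← hj, pbCost_single_self, pbCost_single_of_ne _ _ _ hpq, hb, h10, h01]
        simp only [sub_self, abs_zero]
        linarith
      · rw [pbCost_single_of_ne _ _ _ hpq, pbCost_single_of_ne _ _ _ hj]

/-- with `n_a = n_b = 1` and `m ≥ 2` items, for any biases and any
empty-item cost `c ≥ 0`, a Nash stable arrangement exists, both for the median and the
mean outcome function. -/
theorem stmt10 (m : ℕ) (hm : 2 ≤ m) (βa βb c : ℝ) (hc : 0 ≤ c) :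
    (∃ a b : Fin m → ℕ, (∑ i, a i = 1) ∧ (∑ i, b i = 1) ∧
      NashStable (medOut βa βb) βa βb c a b) ∧
    (∃ a b : Fin m → ℕ, (∑ i, a i = 1) ∧ (∑ i, b i = 1) ∧
      NashStable (meanOut βa βb) βa βb c a b) := by
  exact ⟨exists_nashStable_one_one hm _ βa βb c (by simp [medOut]) (by simp [medOut])
      (by simp [medOut]),
    exists_nashStable_one_one hm _ βa βb c (by simp [meanOut]) (by simp [meanOut])
      (by norm_num [meanOut])⟩
end

section
/- For the median outcome function: for every n and m with 2 < n < m, taking n_a = n − 1 agents of bias β_a = −1/2, n_b = 1 agent of bias β_b = 1, and empty-item cost c = 3/10, there is no Nash stable arrangement of the n agents onto the m items. -/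
open Finset

/-- Comparing sums of functions that agree off two points reduces to those points. -/
theorem add_le_add_of_sum_le_sum {ι : Type*} [Fintype ι] [DecidableEq ι] {g g' : ι → ℝ}
    {i j : ι} (hij : i ≠ j) (hoff : ∀ k, k ≠ i → k ≠ j → g k = g' k)
    (hsum : ∑ k, g k ≤ ∑ k, g' k) : g i + g j ≤ g' i + g' j := by
  have hj : j ∈ univ.erase i := mem_erase.2 ⟨hij.symm, mem_univ j⟩
  rw [← add_sum_erase _ g (mem_univ i), ← add_sum_erase _ g hj,
    ← add_sum_erase _ g' (mem_univ i), ← add_sum_erase _ g' hj] at hsum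
  have hrest : ∑ k ∈ (univ.erase i).erase j, g k = ∑ k ∈ (univ.erase i).erase j, g' k :=
    sum_congr rfl fun k hk => by
      simp only [mem_erase, mem_univ, and_true] at hk
      exact hoff k hk.2 hk.1
  linarith

/-- median outcome; for `2 < n < m`, with `n − 1` agents of bias `−1/2`,
one agent of bias `1`, and empty-item cost `3/10`, no Nash stable arrangement exists. -/
theorem stmt11 (n m : ℕ) (h2 : 2 < n) (hnm : n < m) :
    ¬ ∃ a b : Fin m → ℕ, (∑ i, a i = n - 1) ∧ (∑ i, b i = 1) ∧
      NashStable (medOut (-(1 / 2)) 1) (-(1 / 2)) 1 (3 / 10) a b := by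
  rintro ⟨a, b, ha, hb, hs⟩
  obtain ⟨k, hk⟩ : ∃ k, b k ≠ 0 := by
    by_contra! h
    simp [h] at hb
  have hbk : b k + ∑ i ∈ univ.erase k, b i = 1 := by rw [add_sum_erase _ b (mem_univ k), hb]
  have hk1 : b k = 1 := by omega
  have hb0 : ∀ i, i ≠ k → b i = 0 := fun i hi => by
    have := single_le_sum (f := b) (fun _ _ => Nat.zero_le _)
      (mem_erase.2 ⟨hi, mem_univ i⟩)
    omega
  have hak : a k + ∑ i ∈ univ.erase k, a i = n - 1 := by rw [add_sum_erase _ a (mem_univ k), ha]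
  by_cases h : 2 ≤ a k
  · -- The type-B agent is outvoted and prefers to fill an empty item.
    obtain ⟨j, hj⟩ : ∃ j, a j + b j = 0 := by
      by_contra! h
      have h1 : ∑ _i : Fin m, 1 ≤ ∑ i, (a i + b i) :=
        sum_le_sum fun i _ => Nat.one_le_iff_ne_zero.2 (h i)
      rw [sum_add_distrib, ha, hb] at h1
      simp at h1
      omega
    have hkj : k ≠ j := by
      rintro rfl
      omega
    have hmove := (hs k j hkj).2 hk1.ge
    have hle := add_le_add_of_sum_le_sum hkj
      (fun l hlk hlj => by simp [pbMove, hlk, hlj]) hmove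
    have haj : a j = 0 := by omega
    have hbj : b j = 0 := by omega
    have hpos : 0 < a k := by omega
    have hgt : 1 < a k := by omega
    simp [pbMove, medOut, hkj, haj, hbj, hk1, hpos, hpos.ne', hgt] at hle
    norm_num at hle
  · -- A type-A agent elsewhere prefers to join the type-B agent.
    obtain ⟨j, hj, haj⟩ : ∃ j ∈ univ.erase k, a j ≠ 0 := by
      apply exists_ne_zero_of_sum_ne_zero
      omega
    have hjk : j ≠ k := (mem_erase.1 hj).1
    have hmove := (hs j k hjk).1 (Nat.one_le_iff_ne_zero.2 haj)
    have hle := add_le_add_of_sum_le_sum hjk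
      (fun l hlj hlk => by simp [pbMove, hlk, hlj]) hmove
    have hbj := hb0 j hjk
    have hpos : 0 < a j := Nat.pos_of_ne_zero haj
    obtain h0 | h1 : a k = 0 ∨ a k = 1 := by omega
    all_goals
      by_cases haj1 : a j = 1
      · simp [pbMove, medOut, *] at hle
        norm_num [abs_of_pos] at hle
      · have hgt : 1 < a j := by omega
        have hsub : a j - 1 ≠ 0 := by omega
        simp [pbMove, medOut, hpos.ne', *] at hle
        norm_num [abs_of_pos] at hle
end

section
/- For the mean outcome function: for every n and m with 4 ≤ n < m, taking n_a = n − 1 agents of bias β_a = −1/2, n_b = 1 agent of bias β_b = 1, and any empty-item cost c with 1/8 < c < 1/4, there is no Nash stable arrangement of the n agents onto the m items. -/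
open Finset

/-- Cost to an agent of bias `β` of a single item holding `x` type-A and `y` type-B agents. -/
noncomputable def itemCost (f : ℕ → ℕ → ℝ) (β c : ℝ) (x y : ℕ) : ℝ :=
  if x + y = 0 then c else |f x y - β|

theorem sum_le_sum_iff_of_eq_off_pair {ι : Type*} [Fintype ι] {F G : ι → ℝ} {i j : ι}
    (hij : i ≠ j) (h : ∀ k, k ≠ i → k ≠ j → F k = G k) :
    ∑ k, F k ≤ ∑ k, G k ↔ F i + F j ≤ G i + G j := by
  classical
  have key : ∑ k ∈ {i, j}, (G k - F k) = ∑ k, (G k - F k) := by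
    refine Finset.sum_subset (Finset.subset_univ _) fun k _ hk => ?_
    simp only [Finset.mem_insert, Finset.mem_singleton, not_or] at hk
    rw [h k hk.1 hk.2, sub_self]
  rw [Finset.sum_pair hij, Finset.sum_sub_distrib] at key
  constructor <;> intro _ <;> linarith

theorem pbMove_source {m : ℕ} (x : Fin m → ℕ) {i j : Fin m} (hij : i ≠ j) :
    pbMove x i j i = x i - 1 := by
  simp [pbMove, hij]

theorem pbMove_target {m : ℕ} (x : Fin m → ℕ) (i j : Fin m) :
    pbMove x i j j = x j + 1 := by
  simp [pbMove]

theorem pbMove_of_ne {m : ℕ} (x : Fin m → ℕ) {i j k : Fin m} (hi : k ≠ i) (hj : k ≠ j) :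
    pbMove x i j k = x k := by
  simp [pbMove, hi, hj]

theorem NashStable.itemCost_le_of_move_a {m : ℕ} {f : ℕ → ℕ → ℝ} {βa βb c : ℝ}
    {a b : Fin m → ℕ} (h : NashStable f βa βb c a b) {i j : Fin m} (hij : i ≠ j)
    (hi : 1 ≤ a i) :
    itemCost f βa c (a i) (b i) + itemCost f βa c (a j) (b j) ≤
      itemCost f βa c (a i - 1) (b i) + itemCost f βa c (a j + 1) (b j) := by
  have := (sum_le_sum_iff_of_eq_off_pair (F := fun k => itemCost f βa c (a k) (b k))
    (G := fun k => itemCost f βa c (pbMove a i j k) (b k)) hij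
    fun k hki hkj => by rw [pbMove_of_ne a hki hkj]).1 ((h i j hij).1 hi)
  simpa only [pbMove_source a hij, pbMove_target] using this

theorem NashStable.itemCost_le_of_move_b {m : ℕ} {f : ℕ → ℕ → ℝ} {βa βb c : ℝ}
    {a b : Fin m → ℕ} (h : NashStable f βa βb c a b) {i j : Fin m} (hij : i ≠ j)
    (hi : 1 ≤ b i) :
    itemCost f βb c (a i) (b i) + itemCost f βb c (a j) (b j) ≤
      itemCost f βb c (a i) (b i - 1) + itemCost f βb c (a j) (b j + 1) := by
  have := (sum_le_sum_iff_of_eq_off_pair (F := fun k => itemCost f βb c (a k) (b k))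
    (G := fun k => itemCost f βb c (a k) (pbMove b i j k)) hij
    fun k hki hkj => by rw [pbMove_of_ne b hki hkj]).1 ((h i j hij).2 hi)
  simpa only [pbMove_source b hij, pbMove_target] using this

theorem itemCost_empty (f : ℕ → ℕ → ℝ) (β c : ℝ) : itemCost f β c 0 0 = c := by
  simp [itemCost]

theorem itemCost_meanOut_a_pure (βa βb c : ℝ) {x : ℕ} (hx : 1 ≤ x) :
    itemCost (meanOut βa βb) βa c x 0 = 0 := by
  have hx' : (x : ℝ) ≠ 0 := by positivity
  simp [itemCost, meanOut, Nat.ne_of_gt hx, hx']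

theorem itemCost_meanOut_a_one (βa βb c : ℝ) (x : ℕ) :
    itemCost (meanOut βa βb) βa c x 1 = |βb - βa| / (x + 1) := by
  have hx : (0 : ℝ) < x + 1 := by positivity
  have hout : (x * βa + 1 * βb) / (x + 1) - βa = (βb - βa) / (x + 1) := by
    field_simp
    ring
  rw [itemCost, if_neg (by omega), meanOut, Nat.cast_one, hout, abs_div, abs_of_pos hx]

theorem itemCost_meanOut_b_pure (βa βb c : ℝ) {x : ℕ} (hx : 1 ≤ x) :
    itemCost (meanOut βa βb) βb c x 0 = |βa - βb| := by
  have hx' : (x : ℝ) ≠ 0 := by positivity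
  simp [itemCost, meanOut, Nat.ne_of_gt hx, hx']

theorem itemCost_meanOut_b_one (βa βb c : ℝ) (x : ℕ) :
    itemCost (meanOut βa βb) βb c x 1 = x * |βa - βb| / (x + 1) := by
  have hx : (0 : ℝ) < x + 1 := by positivity
  have hout : (x * βa + 1 * βb) / (x + 1) - βb = x * (βa - βb) / (x + 1) := by
    field_simp
    ring
  rw [itemCost, if_neg (by omega), meanOut, Nat.cast_one, hout, abs_div, abs_mul,
    Nat.abs_cast, abs_of_pos hx]

theorem exists_unique_support_of_sum_eq_one {m : ℕ} {b : Fin m → ℕ} (hb : ∑ i, b i = 1) :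
    ∃ p, b p = 1 ∧ ∀ i, i ≠ p → b i = 0 := by
  obtain ⟨p, hp⟩ : ∃ p, b p ≠ 0 := by
    by_contra! h
    simp [h] at hb
  have hsplit := Finset.add_sum_erase Finset.univ b (Finset.mem_univ p)
  refine ⟨p, by omega, fun i hi => ?_⟩
  have := Finset.single_le_sum (f := b) (fun _ _ => Nat.zero_le _)
    (Finset.mem_erase.2 ⟨hi, Finset.mem_univ i⟩)
  omega

theorem exists_empty_item {m : ℕ} {a b : Fin m → ℕ} (h : ∑ i, a i + ∑ i, b i < m) :
    ∃ e, a e = 0 ∧ b e = 0 := by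
  by_contra! hne
  have := Finset.card_nsmul_le_sum Finset.univ (fun i => a i + b i) 1
    fun i _ => by have := hne i; omega
  rw [Finset.sum_add_distrib] at this
  simp at this
  omega

theorem exists_ne_pos_of_lt_sum {m : ℕ} {a : Fin m → ℕ} {p : Fin m} (h : a p < ∑ i, a i) :
    ∃ q, q ≠ p ∧ 1 ≤ a q := by
  by_contra! hne
  rw [Finset.sum_eq_single p (fun i _ hi => by have := hne i hi; omega) (by simp)] at h
  omega

/-- mean outcome; for `4 ≤ n < m`, with `n − 1` agents of bias `−1/2`,
one agent of bias `1`, and any empty-item cost `c ∈ (1/8, 1/4)`, no Nash stable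
arrangement exists. -/
theorem stmt12 (n m : ℕ) (h4 : 4 ≤ n) (hnm : n < m) (c : ℝ)
    (hc1 : 1 / 8 < c) (hc2 : c < 1 / 4) :
    ¬ ∃ a b : Fin m → ℕ, (∑ i, a i = n - 1) ∧ (∑ i, b i = 1) ∧
      NashStable (meanOut (-(1 / 2)) 1) (-(1 / 2)) 1 c a b := by
  rintro ⟨a, b, ha, hb, hS⟩
  obtain ⟨p, hbp, hb0⟩ := exists_unique_support_of_sum_eq_one hb
  obtain ⟨e, hae, hbe⟩ := exists_empty_item (a := a) (b := b) (by omega)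
  have hep : e ≠ p := by
    rintro rfl
    omega
  have habs : |(1 : ℝ) - -(1 / 2)| = 3 / 2 := by norm_num
  have habs' : |-(1 / 2) - (1 : ℝ)| = 3 / 2 := by norm_num
  -- Leaving the type-B agent's item for an empty one pays as soon as it holds three type-A agents.
  have hle : a p ≤ 2 := by
    by_contra! h3
    have h := hS.itemCost_le_of_move_a hep.symm (by omega)
    rw [hae, hbe, hbp, itemCost_empty, itemCost_meanOut_a_one, itemCost_meanOut_a_one,
      itemCost_meanOut_a_pure _ _ _ (by omega), habs] at h
    obtain ⟨k, hk⟩ := Nat.exists_eq_add_of_le' h3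
    rw [hk, show k + (2 + 1) - 1 = k + 2 by omega] at h
    push_cast at h
    have hgap : (3 / 2 : ℝ) / (k + 2 + 1) - 3 / 2 / (k + (2 + 1) + 1) ≤ 1 / 8 := by
      rw [div_sub_div _ _ (by positivity) (by positivity), div_le_div_iff₀ (by positivity)
        (by positivity)]
      nlinarith [(Nat.cast_nonneg k : (0 : ℝ) ≤ k)]
    linarith
  obtain ⟨q, hqp, haq⟩ := exists_ne_pos_of_lt_sum (a := a) (p := p) (by omega)
  have hbq := hb0 q hqp
  -- All other type-A agents sit alone.
  have hq1 : a q = 1 := by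
    by_contra hne
    have hqe : q ≠ e := by
      rintro rfl
      omega
    have h := hS.itemCost_le_of_move_a hqe haq
    rw [hae, hbe, hbq, itemCost_empty, itemCost_meanOut_a_pure _ _ _ haq,
      itemCost_meanOut_a_pure _ _ _ (by omega), itemCost_meanOut_a_pure _ _ _ (by omega)] at h
    linarith
  have hA := hS.itemCost_le_of_move_a hqp haq
  have hB := hS.itemCost_le_of_move_b hqp.symm hbp.ge
  rw [hq1, hbq, hbp, Nat.sub_self, itemCost_empty, itemCost_meanOut_a_pure _ _ _ le_rfl,
    itemCost_meanOut_a_one, itemCost_meanOut_a_one, habs] at hA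
  rw [hq1, hbq, hbp, Nat.sub_self, itemCost_meanOut_b_pure _ _ _ le_rfl, zero_add,
    itemCost_meanOut_b_one, itemCost_meanOut_b_one, habs'] at hB
  interval_cases hap : a p
  · norm_num at hA
    linarith
  · norm_num at hA
    linarith
  · rw [itemCost_meanOut_b_pure _ _ _ (by norm_num), habs'] at hB
    norm_num at hB
end

section
/- In the weighted Private Blotto game with mean outcome on m = 2 items and β_a ≠ β_b: for all natural numbers n_a ≥ n_b ≥ 1, there exist positive weights w_1, w_2 and an empty-item cost c ≥ (max(w_1,w_2)/min(w_1,w_2))·(1/2)·|β_a − β_b| such that a Nash stable arrangement of the n_a type-A and n_b type-B agents onto the two items exists. -/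
open Finset

/-- Weighted total cost, with item weights `w`, per-item outcome function `f`, to an
agent of bias `β`, with empty-item cost `c`. -/
noncomputable def wCost {m : ℕ} (w : Fin m → ℝ) (f : ℕ → ℕ → ℝ) (β c : ℝ)
    (a b : Fin m → ℕ) : ℝ :=
  ∑ i, if a i + b i = 0 then w i * c else w i * |f (a i) (b i) - β|

/-- Nash stability in the weighted game: no single agent can strictly decrease its own
total cost by moving from one item to another. -/
def WNashStable {m : ℕ} (w : Fin m → ℝ) (f : ℕ → ℕ → ℝ) (βa βb c : ℝ)
    (a b : Fin m → ℕ) : Prop :=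
  ∀ i j : Fin m, i ≠ j →
    (1 ≤ a i → wCost w f βa c a b ≤ wCost w f βa c (pbMove a i j) b) ∧
    (1 ≤ b i → wCost w f βb c a b ≤ wCost w f βb c a (pbMove b i j))

theorem abs_meanOut_sub_left (βa βb : ℝ) {x y : ℕ} (h : x + y ≠ 0) :
    |meanOut βa βb x y - βa| = |βa - βb| * (y / (x + y)) := by
  have h' : (0 : ℝ) < x + y := by exact_mod_cast Nat.pos_of_ne_zero h
  have : meanOut βa βb x y - βa = -(βa - βb) * (y / (x + y)) := by
    unfold meanOut
    field_simp
    ring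
  rw [this, abs_mul, abs_neg, abs_of_nonneg (a := (y : ℝ) / (x + y)) (by positivity)]

theorem abs_meanOut_sub_right (βa βb : ℝ) {x y : ℕ} (h : x + y ≠ 0) :
    |meanOut βa βb x y - βb| = |βa - βb| * (x / (x + y)) := by
  have h' : (0 : ℝ) < x + y := by exact_mod_cast Nat.pos_of_ne_zero h
  have : meanOut βa βb x y - βb = (βa - βb) * (x / (x + y)) := by
    unfold meanOut
    field_simp
    ring
  rw [this, abs_mul, abs_of_nonneg (a := (x : ℝ) / (x + y)) (by positivity)]

theorem wCost_two (w₁ w₂ : ℝ) (f : ℕ → ℕ → ℝ) (β c : ℝ) (a₁ a₂ b₁ b₂ : ℕ) :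
    wCost ![w₁, w₂] f β c ![a₁, a₂] ![b₁, b₂] =
      (if a₁ + b₁ = 0 then w₁ * c else w₁ * |f a₁ b₁ - β|) +
        (if a₂ + b₂ = 0 then w₂ * c else w₂ * |f a₂ b₂ - β|) := by
  exact Fin.sum_univ_two _

theorem pbMove_zero_one (x y : ℕ) : pbMove ![x, y] 0 1 = ![x - 1, y + 1] := by
  ext k
  fin_cases k <;> simp [pbMove]

theorem pbMove_one_zero (x y : ℕ) : pbMove ![x, y] 1 0 = ![x + 1, y - 1] := by
  ext k
  fin_cases k <;> simp [pbMove]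

/-- A lone type-A agent on a light item is stable against everyone else on a heavy item, when
emptying an item is expensive. -/
theorem wNashStable_lone_agent (βa βb : ℝ) (p r : ℕ) (hr : r ≤ p) :
    WNashStable ![1, ((p : ℝ) + r + 2) ^ 2] (meanOut βa βb) βa βb
      (((p : ℝ) + r + 2) ^ 2 * |βa - βb|) ![1, p] ![0, r + 1] := by
  have hD := abs_nonneg (βa - βb)
  have hW : (1 : ℝ) ≤ ((p : ℝ) + r + 2) ^ 2 :=
    one_le_pow₀ (by linarith [Nat.cast_nonneg (α := ℝ) p, Nat.cast_nonneg (α := ℝ) r])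
  intro i j hij
  have hcases : (i = 0 ∧ j = 1) ∨ (i = 1 ∧ j = 0) := by
    fin_cases i <;> fin_cases j <;> simp_all
  rcases hcases with ⟨rfl, rfl⟩ | ⟨rfl, rfl⟩
  · refine ⟨fun _ => ?_, fun h => by simp at h⟩
    rw [pbMove_zero_one, wCost_two, wCost_two, if_neg (by omega), if_neg (by omega),
      if_pos (by omega), if_neg (by omega), abs_meanOut_sub_left _ _ (by omega),
      abs_meanOut_sub_left _ _ (by omega), abs_meanOut_sub_left _ _ (by omega)]
    have h1 : (((r + 1 : ℕ) : ℝ) / (p + (r + 1 : ℕ))) ≤ 1 :=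
      div_le_one_of_le₀ (by simp) (by positivity)
    have h2 : (0 : ℝ) ≤ (((r + 1 : ℕ) : ℝ) / ((p + 1 : ℕ) + (r + 1 : ℕ))) := by positivity
    have h3 := mul_le_mul_of_nonneg_left (mul_le_mul_of_nonneg_left h1 hD) (zero_le_one.trans hW)
    have h4 := mul_nonneg (zero_le_one.trans hW) (mul_nonneg hD h2)
    simp only [Nat.cast_zero, zero_div, mul_zero, mul_one] at h3 ⊢
    linarith
  · constructor
    · intro h
      obtain ⟨k, rfl⟩ : ∃ k, p = k + 1 := ⟨p - 1, by simp at h; omega⟩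
      rw [pbMove_one_zero, wCost_two, wCost_two, if_neg (by omega), if_neg (by omega),
        if_neg (by omega), if_neg (by omega), abs_meanOut_sub_left _ _ (by omega),
        abs_meanOut_sub_left _ _ (by omega), abs_meanOut_sub_left _ _ (by omega),
        abs_meanOut_sub_left _ _ (by omega)]
      simp only [Nat.cast_zero, zero_div, mul_zero, zero_add, Nat.add_sub_cancel]
      gcongr
      omega
    · intro _
      rcases Nat.eq_zero_or_pos p with rfl | hp
      · obtain rfl : r = 0 := by omega
        rw [pbMove_one_zero, wCost_two, wCost_two, if_neg (by omega), if_neg (by omega),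
          if_neg (by omega), if_pos (by omega), abs_meanOut_sub_right _ _ (by omega),
          abs_meanOut_sub_right _ _ (by omega), abs_meanOut_sub_right _ _ (by omega)]
        norm_num
        linarith
      · rw [pbMove_one_zero, wCost_two, wCost_two, if_neg (by omega), if_neg (by omega),
          if_neg (by omega), if_neg (by omega), abs_meanOut_sub_right _ _ (by omega),
          abs_meanOut_sub_right _ _ (by omega), abs_meanOut_sub_right _ _ (by omega),
          abs_meanOut_sub_right _ _ (by omega)]
        have hp' : (1 : ℝ) ≤ p := by exact_mod_cast hp
        have hr' : (0 : ℝ) ≤ r := r.cast_nonneg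
        have key : (1 : ℝ) / 2 + ((p : ℝ) + r + 2) ^ 2 * (p / (p + (r + 1))) ≤
            ((p : ℝ) + r + 2) ^ 2 * (p / (p + r)) := by
          have hdiff : ((p : ℝ) + r + 2) ^ 2 * (p / (p + r)) -
              ((p : ℝ) + r + 2) ^ 2 * (p / (p + (r + 1))) =
              ((p : ℝ) + r + 2) ^ 2 * p / ((p + r) * (p + (r + 1))) := by
            field_simp
            ring
          have hone : 1 ≤ ((p : ℝ) + r + 2) ^ 2 * p / ((p + r) * (p + (r + 1))) := by
            rw [one_le_div (by positivity)]
            calc ((p : ℝ) + r) * (p + (r + 1)) ≤ (p + r + 2) ^ 2 := by nlinarith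
              _ ≤ (p + r + 2) ^ 2 * p := le_mul_of_one_le_right (by positivity) hp'
          linarith
        have := mul_le_mul_of_nonneg_left key hD
        norm_num
        linarith

/-- weighted game, mean outcome, `m = 2` items, `β_a ≠ β_b`: for all
`n_a ≥ n_b ≥ 1` there exist positive weights `w_1, w_2` and an empty-item cost
`c ≥ (max(w_1,w_2)/min(w_1,w_2))·(1/2)·|β_a − β_b|` for which a Nash stable
arrangement exists. -/
theorem stmt18 (βa βb : ℝ) (hβ : βa ≠ βb) (na nb : ℕ) (h1 : 1 ≤ nb) (h2 : nb ≤ na) :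
    ∃ w₁ w₂ : ℝ, 0 < w₁ ∧ 0 < w₂ ∧
      ∃ c : ℝ, (max w₁ w₂ / min w₁ w₂) * ((1 / 2) * |βa - βb|) ≤ c ∧
        ∃ a b : Fin 2 → ℕ, (∑ i, a i = na) ∧ (∑ i, b i = nb) ∧
          WNashStable ![w₁, w₂] (meanOut βa βb) βa βb c a b := by
  obtain ⟨r, rfl⟩ : ∃ r, nb = r + 1 := ⟨nb - 1, by omega⟩
  obtain ⟨p, rfl⟩ : ∃ p, na = p + 1 := ⟨na - 1, by omega⟩
  have hD := abs_nonneg (βa - βb)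
  have hW : (1 : ℝ) ≤ ((p : ℝ) + r + 2) ^ 2 :=
    one_le_pow₀ (by linarith [Nat.cast_nonneg (α := ℝ) p, Nat.cast_nonneg (α := ℝ) r])
  refine ⟨1, ((p : ℝ) + r + 2) ^ 2, one_pos, by positivity, ((p : ℝ) + r + 2) ^ 2 * |βa - βb|, ?_,
    ![1, p], ![0, r + 1], ?_, ?_, wNashStable_lone_agent βa βb p r (by omega)⟩
  · rw [max_eq_right hW, min_eq_left hW, div_one]
    gcongr
    linarith
  · simp [Fin.sum_univ_two, add_comm]
  · simp [Fin.sum_univ_two]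
end
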